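/- Every sequence S_1, …, S_{n-1} of subsets of {1, 2, …, n} satisfying |⋃_{i=1}^{k} S_i| ≤ k for every 1 ≤ k ≤ n−1 is the encoding of a unique directed acyclic graph on the labeled vertex set {1, 2, …, n}; that is, there is exactly one DAG on {1, 2, …, n} whose encoding equals S_1, …, S_{n-1}. -/

import Mathlib

/-- A directed graph on vertex set `Fin n` (a relation `E`) is a DAG iff its
transitive closure is irreflexive, i.e. it has no directed cycle. -/
def IsDag {n : ℕ} (E : Fin n → Fin n → Prop) : Prop :=
  ∀ v : Fin n, ¬ Relation.TransGen E v v

/-- `u` (used with 1-based indices `1, …, n`) is the minimal source sequence of `E`: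
for each `1 ≤ i ≤ n`, `u i` is the least vertex that is a source of the subgraph
induced on the vertices remaining after deleting `u 1, …, u (i-1)`. -/
def IsMinSourceSeq {n : ℕ} (E : Fin n → Fin n → Prop) (u : ℕ → Fin n) : Prop :=
  ∀ i : ℕ, 1 ≤ i → i ≤ n →
    IsLeast {v : Fin n |
      (∀ j : ℕ, 1 ≤ j → j < i → v ≠ u j) ∧
      ∀ w : Fin n, (∀ j : ℕ, 1 ≤ j → j < i → w ≠ u j) → ¬ E w v} (u i)

/-- `S` (used with indices `0, …, n-1`) is the encoding of the DAG `E` with minimal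
source sequence `u`: for every `1 ≤ i ≤ n`, `S (n - i)` is the set of out-neighbors
of `u i` in `E` (so `S 0 = ∅` always, and the encoding proper is `S 1, …, S (n-1)`). -/
def IsEncoding {n : ℕ} (E : Fin n → Fin n → Prop) (u : ℕ → Fin n)
    (S : ℕ → Finset (Fin n)) : Prop :=
  IsMinSourceSeq E u ∧
    ∀ i : ℕ, 1 ≤ i → i ≤ n → ∀ v : Fin n, v ∈ S (n - i) ↔ E (u i) v

/-- `u 1, …, u n` greedily picks the least vertex that is neither picked before
nor contained in `S 1, …, S (n - i)`. -/
def IsGreedySeq {n : ℕ} (S : ℕ → Finset (Fin n)) (u : ℕ → Fin n) : Prop :=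
  ∀ i : ℕ, 1 ≤ i → i ≤ n →
    IsLeast {v : Fin n |
      (∀ j : ℕ, 1 ≤ j → j < i → v ≠ u j) ∧
      ∀ k : ℕ, 1 ≤ k → k ≤ n - i → v ∉ S k} (u i)

/-- The greedy sequence of `S`, with value `0` where no vertex is available. -/
noncomputable def greedySeq {n : ℕ} [NeZero n] (S : ℕ → Finset (Fin n)) (i : ℕ) : Fin n :=
  let c : Finset (Fin n) :=
    ((Finset.Icc 1 (n - i)).biUnion S ∪
      (Finset.Ico 1 i).attach.image fun j => greedySeq S j.1)ᶜ
  if h : c.Nonempty then c.min' h else 0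
termination_by i
decreasing_by exact (Finset.mem_Ico.mp j.2).2

theorem isGreedySeq_greedySeq {n : ℕ} [NeZero n] (S : ℕ → Finset (Fin n))
    (hS : ∀ k : ℕ, 1 ≤ k → k ≤ n - 1 → ((Finset.Icc 1 k).biUnion S).card ≤ k) :
    IsGreedySeq S (greedySeq S) := by
  intro i hi hin
  set c : Finset (Fin n) :=
    ((Finset.Icc 1 (n - i)).biUnion S ∪
      (Finset.Ico 1 i).attach.image fun j => greedySeq S j.1)ᶜ with hc
  have hne : c.Nonempty := by
    have hcard : ((Finset.Icc 1 (n - i)).biUnion S).card ≤ n - i := by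
      rcases Nat.eq_zero_or_pos (n - i) with h | h
      · simp [h]
      · exact hS _ h (by omega)
    have himage :
        ((Finset.Ico 1 i).attach.image fun j => greedySeq S j.1).card ≤ i - 1 :=
      Finset.card_image_le.trans (by simp)
    have hunion := Finset.card_union_le ((Finset.Icc 1 (n - i)).biUnion S)
      ((Finset.Ico 1 i).attach.image fun j => greedySeq S j.1)
    rw [← Finset.card_pos, hc, Finset.card_compl, Fintype.card_fin]
    omega
  have hval : greedySeq S i = c.min' hne := by
    rw [greedySeq]
    exact dif_pos hne
  have hset : {v : Fin n |
      (∀ j : ℕ, 1 ≤ j → j < i → v ≠ greedySeq S j) ∧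
      ∀ k : ℕ, 1 ≤ k → k ≤ n - i → v ∉ S k} = (c : Set (Fin n)) := by
    ext v
    simp only [hc, Set.mem_ofPred_eq, Finset.mem_coe, Finset.mem_compl, Finset.mem_union,
      Finset.mem_biUnion, Finset.mem_image, Finset.mem_attach, true_and, Subtype.exists,
      Finset.mem_Icc, Finset.mem_Ico]
    grind
  rw [hset, hval]
  exact c.isLeast_min' hne

theorem IsGreedySeq.eq {n : ℕ} {S : ℕ → Finset (Fin n)} {u u' : ℕ → Fin n}
    (hu : IsGreedySeq S u) (hu' : IsGreedySeq S u') (i : ℕ) (hi : 1 ≤ i) (hin : i ≤ n) :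
    u i = u' i := by
  induction i using Nat.strong_induction_on with
  | _ i ih =>
    have hprev : ∀ v : Fin n, (∀ j : ℕ, 1 ≤ j → j < i → v ≠ u j) ↔
        ∀ j : ℕ, 1 ≤ j → j < i → v ≠ u' j := fun v =>
      forall_congr' fun j => forall_congr' fun hj => forall_congr' fun hji => by
        rw [ih j hji hj (by omega)]
    have h := hu i hi hin
    simp only [hprev] at h
    exact h.unique (hu' i hi hin)

/-- A sequence of `n` vertices without repetitions visits every vertex. -/
theorem exists_index_of_ne {n : ℕ} {u : ℕ → Fin n}
    (hu : ∀ i : ℕ, 1 ≤ i → i ≤ n → ∀ j : ℕ, 1 ≤ j → j < i → u i ≠ u j) (v : Fin n) :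
    ∃ i, 1 ≤ i ∧ i ≤ n ∧ u i = v := by
  have hinj : Function.Injective fun i : Fin n => u (i + 1) := by
    intro i j hij
    rcases lt_trichotomy i j with h | h | h
    · exact absurd hij.symm (hu _ (by omega) (by omega) _ (by omega) (by omega))
    · exact h
    · exact absurd hij (hu _ (by omega) (by omega) _ (by omega) (by omega))
  obtain ⟨i, hi⟩ := Finite.surjective_of_injective hinj v
  exact ⟨i + 1, by omega, by omega, hi⟩

theorem IsMinSourceSeq.ne {n : ℕ} {E : Fin n → Fin n → Prop} {u : ℕ → Fin n}
    (hu : IsMinSourceSeq E u) (i : ℕ) (hi : 1 ≤ i) (hin : i ≤ n) (j : ℕ) (hj : 1 ≤ j)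
    (hji : j < i) : u i ≠ u j :=
  (hu i hi hin).1.1 j hj hji

theorem IsGreedySeq.ne {n : ℕ} {S : ℕ → Finset (Fin n)} {u : ℕ → Fin n}
    (hu : IsGreedySeq S u) (i : ℕ) (hi : 1 ≤ i) (hin : i ≤ n) (j : ℕ) (hj : 1 ≤ j)
    (hji : j < i) : u i ≠ u j :=
  (hu i hi hin).1.1 j hj hji

/-- The digraph in which `S (n - j)` is the set of out-neighbors of `u j` for `1 ≤ j < n`. -/
def decodedGraph {n : ℕ} (S : ℕ → Finset (Fin n)) (u : ℕ → Fin n) (w v : Fin n) : Prop :=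
  ∃ j : ℕ, 1 ≤ j ∧ j ≤ n - 1 ∧ u j = w ∧ v ∈ S (n - j)

theorem decodedGraph_congr {n : ℕ} {S : ℕ → Finset (Fin n)} {u u' : ℕ → Fin n}
    (h : ∀ i : ℕ, 1 ≤ i → i ≤ n → u i = u' i) : decodedGraph S u = decodedGraph S u' := by
  funext w v
  refine propext (exists_congr fun j => and_congr_right fun hj => and_congr_right fun hjn => ?_)
  rw [h j hj (by omega)]

theorem mem_iff_decodedGraph {n : ℕ} {S : ℕ → Finset (Fin n)} {u : ℕ → Fin n}
    (hu : ∀ i : ℕ, 1 ≤ i → i ≤ n → ∀ j : ℕ, 1 ≤ j → j < i → u i ≠ u j)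
    {i : ℕ} (hi : 1 ≤ i) (hin : i ≤ n - 1) (v : Fin n) :
    v ∈ S (n - i) ↔ decodedGraph S u (u i) v := by
  refine ⟨fun h => ⟨i, hi, hin, rfl, h⟩, ?_⟩
  rintro ⟨j, hj, hjn, hji, hv⟩
  rcases lt_trichotomy i j with h | rfl | h
  · exact absurd hji (hu j hj (by omega) i hi h)
  · exact hv
  · exact absurd hji.symm (hu i hi (by omega) j hj h)

theorem isMinSourceSeq_decodedGraph_iff {n : ℕ} {S : ℕ → Finset (Fin n)} {u : ℕ → Fin n}
    (hu : ∀ i : ℕ, 1 ≤ i → i ≤ n → ∀ j : ℕ, 1 ≤ j → j < i → u i ≠ u j) :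
    IsMinSourceSeq (decodedGraph S u) u ↔ IsGreedySeq S u := by
  refine forall_congr' fun i => forall_congr' fun hi => forall_congr' fun hin => ?_
  suffices h : ∀ v : Fin n,
      (∀ w : Fin n, (∀ j : ℕ, 1 ≤ j → j < i → w ≠ u j) → ¬ decodedGraph S u w v) ↔
        ∀ k : ℕ, 1 ≤ k → k ≤ n - i → v ∉ S k by
    simp only [h]
  intro v
  constructor
  · intro h k hk hkn hv
    refine h (u (n - k)) (fun j hj hji => hu _ (by omega) (by omega) j hj (by omega))
      ⟨n - k, by omega, by omega, rfl, ?_⟩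
    rwa [show n - (n - k) = k by omega]
  · rintro h w hw ⟨j, hj, hjn, rfl, hv⟩
    have hij : i ≤ j := not_lt.mp fun hji => hw j hj hji rfl
    exact h (n - j) (by omega) (by omega) hv

/-- A digraph is recovered from its minimal source sequence and its encoding. -/
theorem IsMinSourceSeq.eq_decodedGraph {n : ℕ} {E : Fin n → Fin n → Prop}
    {S : ℕ → Finset (Fin n)} {u : ℕ → Fin n} (hu : IsMinSourceSeq E u)
    (hE : ∀ i : ℕ, 1 ≤ i → i ≤ n - 1 → ∀ v : Fin n, (v ∈ S (n - i) ↔ E (u i) v)) :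
    E = decodedGraph S u := by
  funext w v
  refine propext ⟨fun h => ?_, ?_⟩
  · obtain ⟨i, hi, hin, rfl⟩ := exists_index_of_ne hu.ne w
    obtain ⟨j, hj, hjn, rfl⟩ := exists_index_of_ne hu.ne v
    have hij : i < j := by
      by_contra hij
      exact (hu j hj hjn).1.2 (u i)
        (fun l hl hlj => hu.ne i hi hin l hl (by omega)) h
    exact ⟨i, hi, by omega, rfl, (hE i hi (by omega) _).mpr h⟩
  · rintro ⟨j, hj, hjn, rfl, hv⟩
    exact (hE j hj hjn v).mp hv

theorem IsMinSourceSeq.isDag {n : ℕ} {E : Fin n → Fin n → Prop} {u : ℕ → Fin n}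
    (hu : IsMinSourceSeq E u) : IsDag E := by
  choose r hr hrn hur using exists_index_of_ne hu.ne
  have hlt : ∀ {w v : Fin n}, E w v → r w < r v := by
    intro w v h
    by_contra hwv
    refine (hu (r v) (hr v) (hrn v)).1.2 w (fun l hl hlv => ?_) (by rwa [hur])
    rw [← hur w]
    exact hu.ne _ (hr w) (hrn w) l hl (by omega)
  intro v hv
  have : Relation.TransGen (· < ·) (r v) (r v) := hv.lift r fun _ _ => hlt
  rw [Relation.transGen_eq_self] at this
  exact lt_irrefl _ this

/-- Every sequence `S 1, …, S (n-1)` of subsets of `{1,…,n}` with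
`|⋃_{i=1}^{k} S i| ≤ k` for every `1 ≤ k ≤ n-1` is the encoding of a unique DAG
on `{1,…,n}`: there is exactly one DAG whose encoding equals `S 1, …, S (n-1)`. -/
theorem existsUnique_dag_with_encoding {n : ℕ} (hn : 1 ≤ n) (S : ℕ → Finset (Fin n))
    (hS : ∀ k : ℕ, 1 ≤ k → k ≤ n - 1 → ((Finset.Icc 1 k).biUnion S).card ≤ k) :
    ∃! E : Fin n → Fin n → Prop,
      IsDag E ∧ ∃ u : ℕ → Fin n, IsMinSourceSeq E u ∧
        ∀ i : ℕ, 1 ≤ i → i ≤ n - 1 → ∀ v : Fin n, (v ∈ S (n - i) ↔ E (u i) v) := by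
  have : NeZero n := ⟨by omega⟩
  have hg := isGreedySeq_greedySeq S hS
  have hsrc := (isMinSourceSeq_decodedGraph_iff hg.ne).mpr hg
  refine ⟨decodedGraph S (greedySeq S),
    ⟨hsrc.isDag, greedySeq S, hsrc, fun i hi hin v => mem_iff_decodedGraph hg.ne hi hin v⟩, ?_⟩
  rintro E ⟨-, u, hu, hE⟩
  obtain rfl := hu.eq_decodedGraph hE
  exact decodedGraph_congr (((isMinSourceSeq_decodedGraph_iff hu.ne).mp hu).eq hg)
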